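/- Let n ≥ 2, let g, h : ℝⁿ → ℝ be twice continuously differentiable on an open set U ⊆ ℝⁿ, let p, q ∈ {1,…,n} with p ≠ q, and suppose g is independent of x_i for every i ≠ p and h is independent of x_i for every i ≠ q. Let B ⊆ U and suppose that for all x ∈ B: g(x) ∈ [g̲, ḡ], h(x) ∈ [h̲, h̄], ∂g/∂x_p(x) ∈ [a̲, ā], ∂h/∂x_q(x) ∈ [b̲, b̄], ∂²g/∂x_p²(x) ∈ [λ̲_g, λ̄_g], and ∂²h/∂x_q²(x) ∈ [λ̲_h, λ̄_h]. Define the intervals [u̲, ū] = [h̲, h̄]·[λ̲_g, λ̄_g], [v̲, v̄] = [g̲, ḡ]·[λ̲_h, λ̄_h], and [c̲, c̄] = [a̲, ā]·[b̲, b̄] (interval products), and set d = 4·max{c̲², c̄²}. Then for every x ∈ B every eigenvalue of the 2×2 reduced Hessian ∇²_{{p,q}}(g·h)(x) lies in the interval [½(u̲ + v̲ − sqrt((u̲ − v̲)² + d)), ½(ū + v̄ + sqrt((ū − v̄)² + d))]. -/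

import Mathlib

open scoped BigOperators

/-- First partial derivative `∂f/∂x_i (x)`. -/
noncomputable def pd {n : ℕ} (f : (Fin n → ℝ) → ℝ) (i : Fin n) (x : Fin n → ℝ) : ℝ :=
  fderiv ℝ f x (Pi.single i 1)

/-- Second partial derivative `∂²f/∂x_i∂x_j (x)` (differentiate w.r.t. `x_j` first, then `x_i`). -/
noncomputable def pd2 {n : ℕ} (f : (Fin n → ℝ) → ℝ) (i j : Fin n) (x : Fin n → ℝ) : ℝ :=
  pd (fun y => pd f j y) i x

/-- Hessian matrix `∇²f(x)` with entries `(∇²f(x))_{ij} = ∂²f/∂x_i∂x_j (x)`. -/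
noncomputable def hess {n : ℕ} (f : (Fin n → ℝ) → ℝ) (x : Fin n → ℝ) :
    Matrix (Fin n) (Fin n) ℝ :=
  Matrix.of fun i j => pd2 f i j x

/-- Reduced Hessian `∇²_J f(x)` indexed by the elements of `J` in ascending order. -/
noncomputable def redHess {n : ℕ} (f : (Fin n → ℝ) → ℝ) (J : Finset (Fin n)) (x : Fin n → ℝ) :
    Matrix (Fin J.card) (Fin J.card) ℝ :=
  Matrix.of fun i j => pd2 f (J.orderIsoOfFin rfl i).1 (J.orderIsoOfFin rfl j).1 x

/-- Every eigenvalue of the (symmetric) matrix `M` lies in `[lo, hi]`. -/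
def eigsIn {m : ℕ} (M : Matrix (Fin m) (Fin m) ℝ) (lo hi : ℝ) : Prop :=
  ∀ (μ : ℝ) (v : Fin m → ℝ), v ≠ 0 → M.mulVec v = μ • v → lo ≤ μ ∧ μ ≤ hi

/-- Lower endpoint of the interval product `[a,b]·[c,d]`. -/
def imulLo (a b c d : ℝ) : ℝ := min (min (a * c) (a * d)) (min (b * c) (b * d))

/-- Upper endpoint of the interval product `[a,b]·[c,d]`. -/
def imulHi (a b c d : ℝ) : ℝ := max (max (a * c) (a * d)) (max (b * c) (b * d))

lemma pd_mul {n : ℕ} {g h : (Fin n → ℝ) → ℝ} {x : Fin n → ℝ} (hg : DifferentiableAt ℝ g x)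
    (hh : DifferentiableAt ℝ h x) (i : Fin n) :
    pd (fun y => g y * h y) i x = g x * pd h i x + h x * pd g i x := by
  simp [pd, fderiv_fun_mul hg hh]

lemma ContDiffAt.differentiableAt_pd {n : ℕ} {f : (Fin n → ℝ) → ℝ} {x : Fin n → ℝ}
    (hf : ContDiffAt ℝ 2 f x) (i : Fin n) : DifferentiableAt ℝ (fun y => pd f i y) x :=
  ((hf.fderiv_right (m := 1) (by norm_num)).differentiableAt (by norm_num)).clm_apply
    (differentiableAt_const _)

lemma pd2_eq_fderiv_fderiv {n : ℕ} {f : (Fin n → ℝ) → ℝ} {x : Fin n → ℝ}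
    (hf : ContDiffAt ℝ 2 f x) (i j : Fin n) :
    pd2 f i j x = fderiv ℝ (fderiv ℝ f) x (Pi.single i 1) (Pi.single j 1) := by
  have hd := (hf.fderiv_right (m := 1) (by norm_num)).differentiableAt (by norm_num)
  simp only [pd2, pd]
  rw [fderiv_clm_apply hd (differentiableAt_const _)]
  simp

lemma pd2_comm {n : ℕ} {f : (Fin n → ℝ) → ℝ} {x : Fin n → ℝ}
    (hf : ContDiffAt ℝ 2 f x) (i j : Fin n) : pd2 f i j x = pd2 f j i x := by
  rw [pd2_eq_fderiv_fderiv hf, pd2_eq_fderiv_fderiv hf]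
  exact hf.isSymmSndFDerivAt (by simp) _ _

lemma pd2_eq_zero {n : ℕ} {f : (Fin n → ℝ) → ℝ} {U : Set (Fin n → ℝ)} (hU : IsOpen U)
    {j : Fin n} (hf : ∀ y ∈ U, pd f j y = 0) {x : Fin n → ℝ} (hx : x ∈ U) (i : Fin n) :
    pd2 f i j x = 0 := by
  have h : (fun y => pd f j y) =ᶠ[nhds x] fun _ => 0 :=
    Filter.eventually_of_mem (hU.mem_nhds hx) hf
  rw [pd2, pd, h.fderiv_eq]
  simp

lemma pd2_mul {n : ℕ} {g h : (Fin n → ℝ) → ℝ} {x : Fin n → ℝ} (hg : ContDiffAt ℝ 2 g x)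
    (hh : ContDiffAt ℝ 2 h x) (i j : Fin n) :
    pd2 (fun y => g y * h y) i j x =
      g x * pd2 h i j x + pd h j x * pd g i x + (h x * pd2 g i j x + pd g j x * pd h i x) := by
  have hgd := hg.differentiableAt (by norm_num)
  have hhd := hh.differentiableAt (by norm_num)
  have heq : (fun y => pd (fun z => g z * h z) j y) =ᶠ[nhds x]
      fun y => g y * pd h j y + h y * pd g j y := by
    filter_upwards [hg.eventually (by simp), hh.eventually (by simp)] with y hy hy'
    exact pd_mul (hy.differentiableAt (by norm_num)) (hy'.differentiableAt (by norm_num)) j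
  have hadd : pd (fun y => g y * pd h j y + h y * pd g j y) i x =
      pd (fun y => g y * pd h j y) i x + pd (fun y => h y * pd g j y) i x := by
    rw [pd, fderiv_fun_add (hgd.fun_mul (hh.differentiableAt_pd j))
      (hhd.fun_mul (hg.differentiableAt_pd j))]
    rfl
  calc pd2 (fun y => g y * h y) i j x = pd (fun y => g y * pd h j y + h y * pd g j y) i x := by
        simp only [pd2]; rw [pd, heq.fderiv_eq, ← pd]
    _ = _ := by
        rw [hadd, pd_mul hgd (hh.differentiableAt_pd j), pd_mul hhd (hg.differentiableAt_pd j)]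
        simp only [pd2]

lemma exists_eigenvector_of_redHess {n : ℕ} {f : (Fin n → ℝ) → ℝ} {J : Finset (Fin n)}
    {x : Fin n → ℝ} {μ : ℝ} {v : Fin J.card → ℝ} (hv : v ≠ 0)
    (h : (redHess f J x).mulVec v = μ • v) :
    ∃ w : Fin n → ℝ, (∃ i ∈ J, w i ≠ 0) ∧
      ∀ i ∈ J, ∑ j ∈ J, pd2 f i j x * w j = μ * w i := by
  classical
  set e := J.orderIsoOfFin rfl with he
  let w : Fin n → ℝ := fun i => if hi : i ∈ J then v (e.symm ⟨i, hi⟩) else 0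
  have hw : ∀ k, w (e k) = v k := fun k => by simp [w]
  refine ⟨w, ?_, fun i hi => ?_⟩
  · obtain ⟨k, hk⟩ := Function.ne_iff.mp hv
    exact ⟨e k, (e k).2, by rw [hw]; exact hk⟩
  · obtain ⟨k, hk⟩ := e.surjective ⟨i, hi⟩
    obtain rfl : (e k : Fin n) = i := by rw [hk]
    have hk' := congrFun h k
    simp only [Matrix.mulVec, dotProduct, redHess, Matrix.of_apply, Pi.smul_apply,
      smul_eq_mul, ← he] at hk'
    rw [hw, ← hk', ← Finset.sum_coe_sort J]
    rw [← e.toEquiv.sum_comp]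
    simp [hw]

lemma sub_mul_sub_eq_sq_of_eigenvector {u v c μ s t : ℝ} (hst : s ≠ 0 ∨ t ≠ 0)
    (h₁ : u * s + c * t = μ * s) (h₂ : c * s + v * t = μ * t) :
    (u - μ) * (v - μ) = c ^ 2 := by
  rcases hst with hs | ht
  · apply mul_right_cancel₀ hs
    linear_combination (v - μ) * h₁ - c * h₂
  · apply mul_right_cancel₀ ht
    linear_combination (u - μ) * h₂ - c * h₁

lemma le_of_sub_mul_sub_eq_sq {u v c μ u₀ v₀ C : ℝ} (hu : u₀ ≤ u) (hv : v₀ ≤ v)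
    (hc : c ^ 2 ≤ C) (h : (u - μ) * (v - μ) = c ^ 2) :
    (u₀ + v₀ - √((u₀ - v₀) ^ 2 + 4 * C)) / 2 ≤ μ := by
  have hC : 0 ≤ C := (sq_nonneg c).trans hc
  set r := √((u₀ - v₀) ^ 2 + 4 * C)
  have hr : r ^ 2 = (u₀ - v₀) ^ 2 + 4 * C := Real.sq_sqrt (by positivity)
  obtain ⟨h₁, h₂⟩ := abs_le.mp (Real.abs_le_sqrt (by linarith : (u₀ - v₀) ^ 2 ≤ (u₀ - v₀) ^ 2 + 4 * C))
  by_contra! hlt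
  have hmul : (u₀ - (u₀ + v₀ - r) / 2) * (v₀ - (u₀ + v₀ - r) / 2) < (u - μ) * (v - μ) :=
    mul_lt_mul'' (by linarith) (by linarith) (by linarith) (by linarith)
  nlinarith

lemma ge_of_sub_mul_sub_eq_sq {u v c μ u₁ v₁ C : ℝ} (hu : u ≤ u₁) (hv : v ≤ v₁)
    (hc : c ^ 2 ≤ C) (h : (u - μ) * (v - μ) = c ^ 2) :
    μ ≤ (u₁ + v₁ + √((u₁ - v₁) ^ 2 + 4 * C)) / 2 := by
  have := le_of_sub_mul_sub_eq_sq (neg_le_neg hu) (neg_le_neg hv) hc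
    (μ := -μ) (by linear_combination h)
  rw [show (-u₁ - -v₁) ^ 2 = (u₁ - v₁) ^ 2 by ring] at this
  linarith

lemma mul_mem_Icc_imul {a b c d x y : ℝ} (hx : x ∈ Set.Icc a b) (hy : y ∈ Set.Icc c d) :
    x * y ∈ Set.Icc (imulLo a b c d) (imulHi a b c d) := by
  obtain ⟨hax, hxb⟩ := hx
  obtain ⟨hcy, hyd⟩ := hy
  simp only [imulLo, imulHi, Set.mem_Icc, min_le_iff, le_max_iff]
  constructor
  · rcases le_total 0 y with h0 | h0
    · have h₁ := mul_le_mul_of_nonneg_right hax h0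
      rcases le_total 0 a with ha | ha
      · exact .inl (.inl ((mul_le_mul_of_nonneg_left hcy ha).trans h₁))
      · exact .inl (.inr ((mul_le_mul_of_nonpos_left hyd ha).trans h₁))
    · have h₁ := mul_le_mul_of_nonpos_right hxb h0
      rcases le_total 0 b with hb | hb
      · exact .inr (.inl ((mul_le_mul_of_nonneg_left hcy hb).trans h₁))
      · exact .inr (.inr ((mul_le_mul_of_nonpos_left hyd hb).trans h₁))
  · rcases le_total 0 y with h0 | h0
    · have h₁ := mul_le_mul_of_nonneg_right hxb h0
      rcases le_total 0 b with hb | hb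
      · exact .inr (.inr (h₁.trans (mul_le_mul_of_nonneg_left hyd hb)))
      · exact .inr (.inl (h₁.trans (mul_le_mul_of_nonpos_left hcy hb)))
    · have h₁ := mul_le_mul_of_nonpos_right hax h0
      rcases le_total 0 a with ha | ha
      · exact .inl (.inr (h₁.trans (mul_le_mul_of_nonneg_left hyd ha)))
      · exact .inl (.inl (h₁.trans (mul_le_mul_of_nonpos_left hcy ha)))

lemma sq_le_max_sq_of_mem_Icc {a b x : ℝ} (hx : x ∈ Set.Icc a b) :
    x ^ 2 ≤ max (a ^ 2) (b ^ 2) := by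
  have h := abs_le_max_abs_abs hx.1 hx.2
  rcases le_max_iff.mp h with h | h
  · exact le_max_of_le_left (sq_le_sq.mpr h)
  · exact le_max_of_le_right (sq_le_sq.mpr h)

theorem stmt16 {n : ℕ} (hn : 2 ≤ n) (U B : Set (Fin n → ℝ)) (hU : IsOpen U) (hBU : B ⊆ U)
    (g h : (Fin n → ℝ) → ℝ) (hg : ContDiffOn ℝ 2 g U) (hh : ContDiffOn ℝ 2 h U)
    (p q : Fin n) (hpq : p ≠ q)
    (hgind : ∀ i : Fin n, i ≠ p → ∀ x ∈ U, pd g i x = 0)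
    (hhind : ∀ i : Fin n, i ≠ q → ∀ x ∈ U, pd h i x = 0)
    (glo ghi hlo hhi alo ahi blo bhi lglo lghi lhlo lhhi : ℝ)
    (hgI : glo ≤ ghi) (hhI : hlo ≤ hhi) (haI : alo ≤ ahi) (hbI : blo ≤ bhi)
    (hlgI : lglo ≤ lghi) (hlhI : lhlo ≤ lhhi)
    (hgB : ∀ x ∈ B, g x ∈ Set.Icc glo ghi)
    (hhB : ∀ x ∈ B, h x ∈ Set.Icc hlo hhi)
    (haB : ∀ x ∈ B, pd g p x ∈ Set.Icc alo ahi)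
    (hbB : ∀ x ∈ B, pd h q x ∈ Set.Icc blo bhi)
    (hlgB : ∀ x ∈ B, pd2 g p p x ∈ Set.Icc lglo lghi)
    (hlhB : ∀ x ∈ B, pd2 h q q x ∈ Set.Icc lhlo lhhi) :
    ∀ x ∈ B, eigsIn (redHess (fun y => g y * h y) {p, q} x)
      ((imulLo hlo hhi lglo lghi + imulLo glo ghi lhlo lhhi -
        Real.sqrt ((imulLo hlo hhi lglo lghi - imulLo glo ghi lhlo lhhi) ^ 2 +
          4 * max ((imulLo alo ahi blo bhi) ^ 2) ((imulHi alo ahi blo bhi) ^ 2))) / 2)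
      ((imulHi hlo hhi lglo lghi + imulHi glo ghi lhlo lhhi +
        Real.sqrt ((imulHi hlo hhi lglo lghi - imulHi glo ghi lhlo lhhi) ^ 2 +
          4 * max ((imulLo alo ahi blo bhi) ^ 2) ((imulHi alo ahi blo bhi) ^ 2))) / 2) := by
  intro x hx μ v hv hμ
  have hxU := hBU hx
  have hgx := hg.contDiffAt (hU.mem_nhds hxU)
  have hhx := hh.contDiffAt (hU.mem_nhds hxU)
  have hgq := hgind q hpq.symm
  have hhp := hhind p hpq
  have hgq2 (i : Fin n) : pd2 g i q x = 0 := pd2_eq_zero hU hgq hxU i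
  have hhp2 (i : Fin n) : pd2 h i p x = 0 := pd2_eq_zero hU hhp hxU i
  have hgqp : pd2 g q p x = 0 := by rw [pd2_comm hgx, hgq2]
  have hhpq : pd2 h p q x = 0 := by rw [pd2_comm hhx, hhp2]
  obtain ⟨w, hw, hsum⟩ := exists_eigenvector_of_redHess hv hμ
  have hp := hsum p (by simp)
  have hq := hsum q (by simp)
  simp only [Finset.sum_pair hpq, pd2_mul hgx hhx, hgq2, hhp2, hgqp, hhpq, hgq x hxU,
    hhp x hxU] at hp hq
  have hdet : (h x * pd2 g p p x - μ) * (g x * pd2 h q q x - μ) = (pd g p x * pd h q x) ^ 2 :=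
    sub_mul_sub_eq_sq_of_eigenvector (s := w p) (t := w q) (by simpa using hw)
      (by linear_combination hp) (by linear_combination hq)
  have hu := mul_mem_Icc_imul (hhB x hx) (hlgB x hx)
  have hv := mul_mem_Icc_imul (hgB x hx) (hlhB x hx)
  have hc := sq_le_max_sq_of_mem_Icc (mul_mem_Icc_imul (haB x hx) (hbB x hx))
  exact ⟨le_of_sub_mul_sub_eq_sq hu.1 hv.1 hc hdet, ge_of_sub_mul_sub_eq_sq hu.2 hv.2 hc hdet⟩
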